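/- arXiv:1601.05376 — 3 statements merged into one kernel-verified Lean document; each statement's English description precedes it below -/
import Mathlib

section
/- Let (A(k))_{k∈ℤⁿ} be a family of densely defined linear operators in H, and assume that for every k ∈ ℤⁿ the residual spectrum of A(k) is empty, i.e. for every λ ∈ ℂ, if λ·id − A(k) is injective then its range is dense in H. Then the residual spectrum of M_A is empty: for every λ ∈ ℂ, if λ·id − M_A is injective then its range is dense in ℓ²(ℤⁿ, H). -/
open MeasureTheory

noncomputable section

/-- The domain of the generalized multiplication operator associated to a family
`A : ι → (H →ₗ.[ℂ] H)` of (possibly unbounded) operators: all `f ∈ ℓ²(ι, H)` such that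
`f k` lies in the domain of `A k` for every `k` and `k ↦ A k (f k)` is again in `ℓ²`. -/
def mulOpDomain {ι H : Type*} [NormedAddCommGroup H] [InnerProductSpace ℂ H]
    (A : ι → (H →ₗ.[ℂ] H)) : Submodule ℂ (lp (fun _ : ι => H) 2) where
  carrier := {f | ∃ h : ∀ k, f k ∈ (A k).domain,
    Memℓp (fun k => A k ⟨f k, h k⟩) 2}
  add_mem' := by
    rintro f g ⟨hf, hf2⟩ ⟨hg, hg2⟩
    have hfg : ∀ k, (↑(f + g) : ∀ _ : ι, H) k ∈ (A k).domain := by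
      intro k; rw [lp.coeFn_add]; exact add_mem (hf k) (hg k)
    refine ⟨hfg, ?_⟩
    have : (fun k => (A k) ⟨(↑(f + g) : ∀ _ : ι, H) k, hfg k⟩)
        = fun k => (A k) ⟨f k, hf k⟩ + (A k) ⟨g k, hg k⟩ := by
      funext k
      rw [← (A k).map_add]
      congr 1
    rw [this]
    exact hf2.add hg2
  zero_mem' := by
    have h0 : ∀ k, (↑(0 : lp (fun _ : ι => H) 2) : ∀ _ : ι, H) k ∈ (A k).domain := by
      intro k; rw [lp.coeFn_zero]; exact zero_mem _
    refine ⟨h0, ?_⟩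
    have : (fun k => (A k) ⟨(↑(0 : lp (fun _ : ι => H) 2) : ∀ _ : ι, H) k, h0 k⟩)
        = fun _ => (0 : H) := by
      funext k
      have : (⟨(↑(0 : lp (fun _ : ι => H) 2) : ∀ _ : ι, H) k, h0 k⟩ : (A k).domain) = 0 := by
        ext; simp [lp.coeFn_zero]
      rw [this, (A k).map_zero]
    rw [this]
    exact zero_memℓp
  smul_mem' := by
    rintro c f ⟨hf, hf2⟩
    have hcf : ∀ k, (↑(c • f) : ∀ _ : ι, H) k ∈ (A k).domain := by
      intro k; rw [lp.coeFn_smul]; exact Submodule.smul_mem _ c (hf k)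
    refine ⟨hcf, ?_⟩
    have : (fun k => (A k) ⟨(↑(c • f) : ∀ _ : ι, H) k, hcf k⟩)
        = fun k => c • (A k) ⟨f k, hf k⟩ := by
      funext k
      rw [← (A k).map_smul]
      congr 1
    rw [this]
    exact hf2.const_smul c
  
/-- The generalized multiplication operator in `ℓ²(ι, H)` associated to a family
`A : ι → (H →ₗ.[ℂ] H)`, acting by `(M_A f) k = A k (f k)`. -/
def mulOp {ι H : Type*} [NormedAddCommGroup H] [InnerProductSpace ℂ H]
    (A : ι → (H →ₗ.[ℂ] H)) :
    lp (fun _ : ι => H) 2 →ₗ.[ℂ] lp (fun _ : ι => H) 2 where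
  domain := mulOpDomain A
  toFun :=
  { toFun := fun f => ⟨fun k => A k ⟨f.1 k, f.2.choose k⟩, f.2.choose_spec⟩
    map_add' := by
      rintro ⟨f, hf⟩ ⟨g, hg⟩
      ext k
      rw [lp.coeFn_add]
      show (A k) _ = (A k) _ + (A k) _
      rw [← (A k).map_add]
      congr 1
    map_smul' := by
      rintro c ⟨f, hf⟩
      ext k
      rw [lp.coeFn_smul]
      show (A k) _ = (c • ((A k) _ : H))
      rw [← (A k).map_smul]
      congr 1 }

theorem mem_mulOpDomain_iff {ι H : Type*} [NormedAddCommGroup H] [InnerProductSpace ℂ H]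
    (A : ι → (H →ₗ.[ℂ] H)) (f : lp (fun _ : ι => H) 2) :
    f ∈ (mulOp A).domain ↔ ∃ h : ∀ k, f k ∈ (A k).domain,
      Memℓp (fun k => A k ⟨f k, h k⟩) 2 := Iff.rfl

theorem mulOp_apply {ι H : Type*} [NormedAddCommGroup H] [InnerProductSpace ℂ H]
    (A : ι → (H →ₗ.[ℂ] H)) (f : (mulOp A).domain) (k : ι)
    (hk : (f : lp (fun _ : ι => H) 2) k ∈ (A k).domain) :
    (mulOp A f : lp (fun _ : ι => H) 2) k = A k ⟨(f : lp (fun _ : ι => H) 2) k, hk⟩ := rfl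

section SingleFiber

variable {ι H : Type*} [DecidableEq ι] [NormedAddCommGroup H] [InnerProductSpace ℂ H]
  (A : ι → (H →ₗ.[ℂ] H))

theorem apply_single_mk (k : ι) (v : (A k).domain) (j : ι)
    (h : (lp.single 2 k (v : H) : lp (fun _ : ι => H) 2) j ∈ (A j).domain) :
    A j ⟨(lp.single 2 k (v : H) : lp (fun _ : ι => H) 2) j, h⟩ =
      (lp.single 2 k (A k v) : lp (fun _ : ι => H) 2) j := by
  obtain rfl | hj := eq_or_ne j k
  · have hv : (⟨_, h⟩ : (A j).domain) = v :=
      Subtype.ext (lp.single_apply_self (E := fun _ : ι => H) 2 j (v : H))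
    exact (congrArg (A j) hv).trans
      (lp.single_apply_self (E := fun _ : ι => H) 2 j (A j v)).symm
  · have h0 : (⟨_, h⟩ : (A j).domain) = 0 :=
      Subtype.ext (lp.single_apply_ne (E := fun _ : ι => H) 2 k (v : H) hj)
    exact ((congrArg (A j) h0).trans (A j).map_zero).trans
      (lp.single_apply_ne (E := fun _ : ι => H) 2 k (A k v) hj).symm

theorem single_mem_mulOp_domain (k : ι) (v : (A k).domain) :
    lp.single 2 k (v : H) ∈ (mulOp A).domain := by
  have h (j : ι) : (lp.single 2 k (v : H) : lp (fun _ : ι => H) 2) j ∈ (A j).domain := by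
    obtain rfl | hj := eq_or_ne j k
    · rw [lp.single_apply_self]
      exact v.2
    · rw [lp.single_apply_ne _ _ _ hj]
      exact zero_mem _
  refine (mem_mulOpDomain_iff A _).2 ⟨h, ?_⟩
  rw [funext fun j => apply_single_mk A k v j (h j)]
  exact lp.memℓp _

theorem mulOp_single (k : ι) (v : (A k).domain) :
    mulOp A ⟨lp.single 2 k (v : H), single_mem_mulOp_domain A k v⟩ = lp.single 2 k (A k v) := by
  obtain ⟨hd, -⟩ := (mem_mulOpDomain_iff A _).1 (single_mem_mulOp_domain A k v)
  exact lp.ext (funext fun j => (mulOp_apply A _ j (hd j)).trans (apply_single_mk A k v j (hd j)))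

theorem smul_sub_mulOp_single (lam : ℂ) (k : ι) (v : (A k).domain) :
    lam • lp.single 2 k (v : H) -
        mulOp A ⟨lp.single 2 k (v : H), single_mem_mulOp_domain A k v⟩ =
      lp.single 2 k (lam • (v : H) - A k v) := by
  rw [mulOp_single, lp.single_sub, lp.single_smul]

theorem injective_smul_sub_of_mulOp {lam : ℂ}
    (hinj : Function.Injective fun f : (mulOp A).domain =>
      lam • (f : lp (fun _ : ι => H) 2) - mulOp A f) (k : ι) :
    Function.Injective fun v : (A k).domain => lam • (v : H) - A k v := by
  intro v w hvw
  have hvw' : (⟨lp.single 2 k (v : H), single_mem_mulOp_domain A k v⟩ : (mulOp A).domain) =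
      ⟨lp.single 2 k (w : H), single_mem_mulOp_domain A k w⟩ := by
    apply hinj
    simp only [smul_sub_mulOp_single]
    exact congrArg (lp.single 2 k) hvw
  exact Subtype.ext ((lp.isometry_single k).injective (congrArg Subtype.val hvw'))

theorem dense_range_smul_sub_mulOp {lam : ℂ}
    (hdense : ∀ k, Dense (Set.range fun v : (A k).domain => lam • (v : H) - A k v)) :
    Dense (Set.range fun f : (mulOp A).domain =>
      lam • (f : lp (fun _ : ι => H) 2) - mulOp A f) := by
  let R := LinearMap.range (lam • (mulOp A).domain.subtype - (mulOp A).toFun)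
  change Dense (R : Set (lp (fun _ : ι => H) 2))
  have hsingle (k : ι) (x : H) : lp.single 2 k x ∈ R.topologicalClosure := by
    refine map_mem_closure (lp.isometry_single (E := fun _ : ι => H) (p := 2) k).continuous
      (hdense k x) ?_
    rintro _ ⟨v, rfl⟩
    exact ⟨⟨_, single_mem_mulOp_domain A k v⟩, smul_sub_mulOp_single A lam k v⟩
  intro f
  exact R.isClosed_topologicalClosure.mem_of_tendsto (lp.hasSum_single (by simp) f)
    (.of_forall fun s => sum_mem fun k _ => hsingle k (f k))

end SingleFiber

/-- If every `A k` is densely defined with empty residual spectrum, then the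
residual spectrum of `M_A` is empty: whenever `λ·id − M_A` is injective, its range is dense. -/
theorem statement3 (n : ℕ) (hn : 1 ≤ n) {H : Type*} [NormedAddCommGroup H]
    [InnerProductSpace ℂ H] [CompleteSpace H] [TopologicalSpace.SeparableSpace H]
    (A : (Fin n → ℤ) → (H →ₗ.[ℂ] H))
    (hA : ∀ k, Dense ((A k).domain : Set H))
    (hres : ∀ (k : Fin n → ℤ) (lam : ℂ),
      Function.Injective (fun v : (A k).domain => lam • (v : H) - A k v) →
      Dense (Set.range fun v : (A k).domain => lam • (v : H) - A k v)) :
    ∀ lam : ℂ,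
      Function.Injective (fun f : (mulOp A).domain =>
        lam • (f : lp (fun _ : Fin n → ℤ => H) 2) - mulOp A f) →
      Dense (Set.range fun f : (mulOp A).domain =>
        lam • (f : lp (fun _ : Fin n → ℤ => H) 2) - mulOp A f) := by
  intro lam hinj
  exact dense_range_smul_sub_mulOp A fun k => hres k lam (injective_smul_sub_of_mulOp A hinj k)
end
end

section
/- Let M_A be the generalized multiplication operator in ℓ²(ℤⁿ, ℂᴺ) associated to the family A(k) = i Σ_{j=1}^n κ_j k_j γ_j, k ∈ ℤⁿ. Then: (i) a complex number λ is an eigenvalue of M_A (i.e. there exists a nonzero f ∈ dom M_A with M_A f = λ f) if and only if λ² = ⟨k,k⟩_{p,q} for some k ∈ ℤⁿ; (ii) for every λ ∈ ℂ with λ² ≠ ⟨k,k⟩_{p,q} for all k ∈ ℤⁿ, the operator λ·id − M_A is injective with dense range and its inverse is unbounded. Consequently σ(M_A) = ℂ = σ_p(M_A) ∪ σ_c(M_A), with σ_p(M_A) = { ±√⟨k,k⟩_{p,q} : k ∈ ℤⁿ } and σ_r(M_A) = ∅. (The paper shows that the closure of the Dirac operator of the flat pseudo-Riemannian torus T^{p,q}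 with the trivial spin structure is unitarily equivalent to M_A via Fourier series, so the same statements hold for its spectrum.) -/
open MeasureTheory

noncomputable section

section MulOp

variable {ι H : Type*} [NormedAddCommGroup H] [InnerProductSpace ℂ H]

/-- The generalized multiplication operator of a family of bounded, everywhere defined
operators. -/
abbrev boundedMulOp (T : ι → H →L[ℂ] H) :
    lp (fun _ : ι => H) 2 →ₗ.[ℂ] lp (fun _ : ι => H) 2 :=
  mulOp fun k => (T k).toLinearMap.toPMap ⊤

theorem boundedMulOp_apply (T : ι → H →L[ℂ] H) (f : (boundedMulOp T).domain) (k : ι) :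
    (boundedMulOp T f : lp (fun _ : ι => H) 2) k = T k ((f : lp (fun _ : ι => H) 2) k) :=
  rfl

theorem map_single [DecidableEq ι] (T : ι → H →L[ℂ] H) (k : ι) (v : H) :
    (fun l => T l ((lp.single 2 k v : lp (fun _ : ι => H) 2) l)) =
      (lp.single 2 k (T k v) : lp (fun _ : ι => H) 2) := by
  funext l
  by_cases h : l = k
  · subst h
    simp
  · simp [h]

theorem single_mem_boundedMulOp_domain [DecidableEq ι] (T : ι → H →L[ℂ] H) (k : ι) (v : H) :
    (lp.single 2 k v : lp (fun _ : ι => H) 2) ∈ (boundedMulOp T).domain := by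
  rw [mem_mulOpDomain_iff]
  refine ⟨fun _ => trivial, ?_⟩
  change Memℓp (fun l => T l ((lp.single 2 k v : lp (fun _ : ι => H) 2) l)) 2
  rw [map_single]
  exact lp.memℓp _

theorem boundedMulOp_single [DecidableEq ι] (T : ι → H →L[ℂ] H) (k : ι) (v : H) :
    boundedMulOp T ⟨lp.single 2 k v, single_mem_boundedMulOp_domain T k v⟩ =
      lp.single 2 k (T k v) :=
  lp.ext (map_single T k v)

theorem smul_sub_boundedMulOp_single [DecidableEq ι] (T : ι → H →L[ℂ] H) (lam : ℂ) (k : ι)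
    (v : H) :
    lam • (lp.single 2 k v : lp (fun _ : ι => H) 2) -
        boundedMulOp T ⟨lp.single 2 k v, single_mem_boundedMulOp_domain T k v⟩ =
      lp.single 2 k (lam • v - T k v) := by
  rw [boundedMulOp_single, lp.single_sub, lp.single_smul]

/-- The eigenvalues of a generalized multiplication operator are the eigenvalues of the
operators in the family. -/
theorem exists_eigenvector_boundedMulOp_iff (T : ι → H →L[ℂ] H) (lam : ℂ) :
    (∃ f : (boundedMulOp T).domain, f ≠ 0 ∧
        boundedMulOp T f = lam • (f : lp (fun _ : ι => H) 2)) ↔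
      ∃ k, ∃ v : H, v ≠ 0 ∧ T k v = lam • v := by
  classical
  constructor
  · rintro ⟨f, hf, h⟩
    by_contra! hne
    refine hf (Subtype.ext (lp.ext (funext fun k => ?_)))
    by_contra hk
    refine hne k _ hk ?_
    rw [← boundedMulOp_apply, h]
    rfl
  · rintro ⟨k, v, hv, h⟩
    refine ⟨⟨lp.single 2 k v, single_mem_boundedMulOp_domain T k v⟩, fun h0 => hv ?_, ?_⟩
    · have := congrArg (fun f : (boundedMulOp T).domain => (f : lp (fun _ : ι => H) 2) k) h0
      simpa using this
    · rw [boundedMulOp_single, h, lp.single_smul]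

theorem injective_smul_sub_boundedMulOp (T : ι → H →L[ℂ] H) (lam : ℂ)
    (hT : ∀ k v, T k v = lam • v → v = 0) :
    Function.Injective fun f : (boundedMulOp T).domain =>
      lam • (f : lp (fun _ : ι => H) 2) - boundedMulOp T f := by
  intro f g h
  refine Subtype.ext (lp.ext (funext fun k => sub_eq_zero.1 (hT k _ ?_)))
  have hk := congrArg (fun f : lp (fun _ : ι => H) 2 => f k) h
  change lam • (f : lp (fun _ : ι => H) 2) k - T k ((f : lp (fun _ : ι => H) 2) k) =
    lam • (g : lp (fun _ : ι => H) 2) k - T k ((g : lp (fun _ : ι => H) 2) k) at hk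
  rw [map_sub, smul_sub, sub_eq_sub_iff_sub_eq_sub.1 hk]

theorem dense_range_smul_sub_boundedMulOp (T : ι → H →L[ℂ] H) (lam : ℂ)
    (hT : ∀ k, Function.Surjective fun v => lam • v - T k v) :
    Dense (Set.range fun f : (boundedMulOp T).domain =>
      lam • (f : lp (fun _ : ι => H) 2) - boundedMulOp T f) := by
  classical
  let S := lam • (boundedMulOp T).domain.subtype - (boundedMulOp T).toFun
  intro g
  refine mem_closure_of_tendsto (lp.hasSum_single (by norm_num) g)
    (Filter.Eventually.of_forall fun s => ?_)
  change _ ∈ (LinearMap.range S : Set (lp (fun _ : ι => H) 2))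
  refine Submodule.sum_mem _ fun k _ => ?_
  obtain ⟨v, hv⟩ := hT k (g k)
  refine ⟨⟨_, single_mem_boundedMulOp_domain T k v⟩, ?_⟩
  rw [← hv]
  exact smul_sub_boundedMulOp_single T lam k v

end MulOp

section Clifford

variable {ι n : Type*} [Fintype ι] [DecidableEq ι] [Fintype n] [DecidableEq n]

theorem sum_smul_mul_self_of_clifford {κ : ι → ℂ} {γ : ι → Matrix n n ℂ}
    (h : ∀ i j, γ i * γ j + γ j * γ i =
      (-2 * κ i * (if i = j then 1 else 0)) • (1 : Matrix n n ℂ)) (c : ι → ℂ) :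
    (∑ j, c j • γ j) * (∑ j, c j • γ j) = (-∑ j, κ j * c j * c j) • (1 : Matrix n n ℂ) := by
  have key : (2 : ℂ) • ((∑ j, c j • γ j) * (∑ j, c j • γ j)) =
      (2 : ℂ) • (-∑ j, κ j * c j * c j) • (1 : Matrix n n ℂ) := by
    calc (2 : ℂ) • ((∑ j, c j • γ j) * (∑ j, c j • γ j))
        = ∑ i, ∑ j, (c i * c j) • (γ i * γ j + γ j * γ i) := by
          simp only [smul_add, Finset.sum_add_distrib, two_smul]
          congr 1
          · simp only [Finset.sum_mul_sum, smul_mul_smul_comm]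
          · rw [Finset.sum_comm]
            simp only [Finset.sum_mul_sum, smul_mul_smul_comm, mul_comm]
      _ = (2 : ℂ) • (-∑ j, κ j * c j * c j) • (1 : Matrix n n ℂ) := by
          simp only [h, smul_smul, ← Finset.sum_smul]
          congr 1
          simp only [mul_ite, mul_one, mul_zero, Finset.sum_ite_eq, Finset.mem_univ, if_true,
            mul_neg, Finset.mul_sum, ← Finset.sum_neg_distrib]
          exact Finset.sum_congr rfl fun j _ => by ring
  exact smul_right_injective _ two_ne_zero key

/-- A traceless matrix whose square is `lam ^ 2` has `lam` as an eigenvalue. -/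
theorem exists_eigenvector_of_trace_eq_zero [Nonempty n] {M : Matrix n n ℂ} {lam : ℂ}
    (hM : M * M = lam ^ 2 • (1 : Matrix n n ℂ)) (htr : M.trace = 0) :
    ∃ v : EuclideanSpace ℂ n, v ≠ 0 ∧ Matrix.toEuclideanCLM (𝕜 := ℂ) M v = lam • v := by
  by_contra! hne
  let L := Matrix.toEuclideanCLM (n := n) (𝕜 := ℂ)
  have hLL : ∀ v, L M (L M v) = lam ^ 2 • v := fun v => by
    rw [← mul_apply_eq_comp, ← map_mul, hM, map_smul, map_one]
    rfl
  have hneg : ∀ v, L M v + lam • v = 0 := fun v => by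
    by_contra hv
    refine hne _ hv ?_
    change L M _ = _
    rw [map_add, hLL, map_smul, smul_add, smul_smul, add_comm, pow_two]
  have hMeq : M = -(lam • 1) := by
    apply EquivLike.injective (Matrix.toEuclideanCLM (n := n) (𝕜 := ℂ))
    ext1 v
    rw [map_neg, map_smul, map_one]
    exact eq_neg_of_add_eq_zero_left (hneg v)
  have hlam : lam = 0 := by
    rw [hMeq] at htr
    simpa using htr
  obtain ⟨v, hv⟩ := exists_ne (0 : EuclideanSpace ℂ n)
  refine hne v hv ?_
  simpa [hlam] using hneg v

end Clifford

/-- An operator family that contains all multiples of a nonzero square-zero operator has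
resolvents that are unbounded. -/
theorem not_bounded_of_sq_eq_zero {ι H : Type*} [NormedAddCommGroup H] [InnerProductSpace ℂ H]
    (T : ι → H →L[ℂ] H) (lam : ℂ) (B : H →L[ℂ] H) (hB : B ≠ 0) (hBB : B * B = 0)
    (hT : ∀ m : ℕ, ∃ k, T k = (m : ℂ) • B) :
    ¬ ∃ C > (0 : ℝ), ∀ f : (boundedMulOp T).domain,
      ‖(f : lp (fun _ : ι => H) 2)‖ ≤
        C * ‖lam • (f : lp (fun _ : ι => H) 2) - boundedMulOp T f‖ := by
  classical
  rintro ⟨C, hC, h⟩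
  obtain ⟨v, hv⟩ : ∃ v, B v ≠ 0 := by
    by_contra! h0
    exact hB (ContinuousLinearMap.ext h0)
  have hBv : B (B v) = 0 := by
    rw [← mul_apply_eq_comp, hBB]
    rfl
  obtain ⟨m, hm⟩ := exists_nat_gt ((C * ‖lam ^ 2 • v‖ + ‖lam • v‖) / ‖B v‖)
  rw [div_lt_iff₀ (norm_pos_iff.2 hv)] at hm
  obtain ⟨k, hk⟩ := hT m
  have hle := h ⟨_, single_mem_boundedMulOp_domain T k (lam • v + (m : ℂ) • B v)⟩
  rw [smul_sub_boundedMulOp_single, lp.norm_single (by norm_num), lp.norm_single (by norm_num)]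
    at hle
  have himg : lam • (lam • v + (m : ℂ) • B v) - T k (lam • v + (m : ℂ) • B v) =
      lam ^ 2 • v := by
    rw [hk]
    simp only [smul_apply, map_add, map_smul, hBv]
    module
  rw [himg] at hle
  have hnorm := norm_sub_le (lam • v + (m : ℂ) • B v) (lam • v)
  rw [add_sub_cancel_left, norm_smul, Complex.norm_natCast] at hnorm
  linarith

/-- Let `γ₁, …, γₙ` be trace-zero, linearly independent complex `N×N`
matrices satisfying the Clifford relations for the signature `(p,q)`, and let `M_A` be the
generalized multiplication operator in `ℓ²(ℤⁿ, ℂᴺ)` associated to the family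
`A k = i Σⱼ κⱼ kⱼ γⱼ`.  Then `λ` is an eigenvalue of `M_A` iff `λ² = ⟨k,k⟩_{p,q}` for some
`k ∈ ℤⁿ`, and for every other `λ` the operator `λ·id − M_A` is injective with dense range and
unbounded inverse; in particular `σ(M_A) = ℂ = σ_p(M_A) ∪ σ_c(M_A)` with
`σ_p(M_A) = {±√⟨k,k⟩_{p,q} : k ∈ ℤⁿ}` and `σ_r(M_A) = ∅`.  (The closure of the Dirac operator
of the flat pseudo-Riemannian torus `T^{p,q}` with the trivial spin structure is unitarily
equivalent to `M_A` via Fourier series.) -/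
theorem statement17 (p q N : ℕ) (hp : 1 ≤ p) (hq : 1 ≤ q) (hN : 1 ≤ N)
    (κ : Fin (p + q) → ℝ) (hκ : ∀ j, κ j = if (j : ℕ) < p then -1 else 1)
    (γ : Fin (p + q) → Matrix (Fin N) (Fin N) ℂ)
    (hcliff : ∀ i j, γ i * γ j + γ j * γ i =
      (-2 * (κ i : ℂ) * (if i = j then 1 else 0)) • (1 : Matrix (Fin N) (Fin N) ℂ))
    (htr : ∀ j, Matrix.trace (γ j) = 0)
    (hli : LinearIndependent ℂ γ)
    (A : (Fin (p + q) → ℤ) →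
      (EuclideanSpace ℂ (Fin N) →ₗ.[ℂ] EuclideanSpace ℂ (Fin N)))
    (hA : ∀ k, A k = (Matrix.toEuclideanCLM (𝕜 := ℂ)
        (Complex.I • ∑ j, ((κ j : ℂ) * ((k j : ℤ) : ℂ)) • γ j)).toLinearMap.toPMap ⊤)
    (lam : ℂ) :
    ((∃ f : (mulOp A).domain, f ≠ 0 ∧
        mulOp A f = lam • (f : lp (fun _ : Fin (p + q) → ℤ => EuclideanSpace ℂ (Fin N)) 2)) ↔
      ∃ k : Fin (p + q) → ℤ,
        lam ^ 2 = ((∑ j, κ j * (k j : ℝ) * (k j : ℝ) : ℝ) : ℂ)) ∧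
    ((∀ k : Fin (p + q) → ℤ,
        lam ^ 2 ≠ ((∑ j, κ j * (k j : ℝ) * (k j : ℝ) : ℝ) : ℂ)) →
      Function.Injective (fun f : (mulOp A).domain =>
        lam • (f : lp (fun _ : Fin (p + q) → ℤ => EuclideanSpace ℂ (Fin N)) 2) -
          mulOp A f) ∧
      Dense (Set.range fun f : (mulOp A).domain =>
        lam • (f : lp (fun _ : Fin (p + q) → ℤ => EuclideanSpace ℂ (Fin N)) 2) -
          mulOp A f) ∧
      ¬ ∃ C > (0 : ℝ), ∀ f : (mulOp A).domain,
        ‖(f : lp (fun _ : Fin (p + q) → ℤ => EuclideanSpace ℂ (Fin N)) 2)‖ ≤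
          C * ‖lam • (f : lp (fun _ : Fin (p + q) → ℤ => EuclideanSpace ℂ (Fin N)) 2) -
            mulOp A f‖) := by
  obtain rfl := funext hA
  have : Nonempty (Fin N) := ⟨⟨0, hN⟩⟩
  set M : (Fin (p + q) → ℤ) → Matrix (Fin N) (Fin N) ℂ := fun k =>
    Complex.I • ∑ j, ((κ j : ℂ) * ((k j : ℤ) : ℂ)) • γ j with hM
  set T := fun k => Matrix.toEuclideanCLM (𝕜 := ℂ) (M k) with hT
  set Q : (Fin (p + q) → ℤ) → ℂ := fun k => ((∑ j, κ j * (k j : ℝ) * (k j : ℝ) : ℝ) : ℂ) with hQ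
  have hκκ : ∀ j, (κ j : ℂ) * κ j = 1 := fun j => by
    rw [hκ]
    split_ifs <;> simp
  have hsq : ∀ k, M k * M k = Q k • (1 : Matrix (Fin N) (Fin N) ℂ) := fun k => by
    simp only [hM, hQ]
    rw [smul_mul_smul_comm, sum_smul_mul_self_of_clifford hcliff, Complex.I_mul_I, smul_smul,
      neg_one_mul, neg_neg]
    congr 1
    push_cast
    refine Finset.sum_congr rfl fun j _ => ?_
    linear_combination (κ j : ℂ) * k j * k j * hκκ j
  have htrM : ∀ k, (M k).trace = 0 := fun k => by
    simp [hM, Matrix.trace_sum, htr]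
  have hTT : ∀ k v, T k (T k v) = Q k • v := fun k v => by
    rw [← mul_apply_eq_comp, hT, ← map_mul, hsq, map_smul, map_one]
    rfl
  refine ⟨(exists_eigenvector_boundedMulOp_iff T lam).trans (exists_congr fun k => ?_),
    fun hlam => ⟨injective_smul_sub_boundedMulOp T lam fun k v h => ?_,
      dense_range_smul_sub_boundedMulOp T lam fun k w => ?_, ?_⟩⟩
  · constructor
    · rintro ⟨v, hv, h⟩
      have h2 := hTT k v
      rw [h, map_smul, h, smul_smul, ← pow_two] at h2
      exact smul_left_injective ℂ hv h2
    · intro h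
      refine exists_eigenvector_of_trace_eq_zero ?_ (htrM k)
      rw [hsq, h]
  · have h2 := hTT k v
    rw [h, map_smul, h, smul_smul, ← pow_two] at h2
    by_contra hv
    exact hlam k (smul_left_injective ℂ hv h2)
  · have hne : lam ^ 2 - Q k ≠ 0 := sub_ne_zero.2 (hlam k)
    refine ⟨(lam ^ 2 - Q k)⁻¹ • (lam • w + T k w), ?_⟩
    simp only [map_smul, map_add, hTT]
    refine Eq.trans ?_ (inv_smul_smul₀ hne w)
    module
  · let a : Fin (p + q) := ⟨0, by omega⟩
    let b : Fin (p + q) := ⟨p, by omega⟩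
    have hab : a ≠ b := by
      simp only [a, b, ne_eq, Fin.mk.injEq]
      omega
    have hκa : κ a = -1 := by
      rw [hκ, if_pos]
      exact hp
    have hκb : κ b = 1 := by
      rw [hκ, if_neg]
      exact lt_irrefl p
    let e : Fin (p + q) → ℤ := Pi.single a 1 + Pi.single b 1
    have hea : e a = 1 := by simp [e, hab]
    have heb : e b = 1 := by simp [e, hab.symm]
    have he : ∀ j, j ≠ a ∧ j ≠ b → e j = 0 := fun j hj => by simp [e, hj.1, hj.2]
    have hQe : Q e = 0 := by
      simp only [hQ]
      rw [Fintype.sum_eq_add a b hab fun j hj => by simp [he j hj], hea, heb, hκa, hκb]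
      norm_num
    refine not_bounded_of_sq_eq_zero T lam (T e) (fun h0 => ?_) ?_ fun m => ⟨m • e, ?_⟩
    · have hM0 : M e = 0 := EquivLike.injective (Matrix.toEuclideanCLM (n := Fin N) (𝕜 := ℂ))
        (h0.trans (map_zero _).symm)
      have hsum := (smul_eq_zero.1 hM0).resolve_left Complex.I_ne_zero
      have := Fintype.linearIndependent_iff.1 hli _ hsum b
      simp [hκb, heb] at this
    · ext1 v
      rw [mul_apply_eq_comp, hTT, hQe, zero_smul]
      rfl
    · simp only [hT]
      rw [← map_smul]
      congr 1
      simp only [hM, Finset.smul_sum, smul_smul]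
      refine Finset.sum_congr rfl fun j _ => ?_
      congr 1
      simp only [Pi.smul_apply, nsmul_eq_mul]
      push_cast
      ring
end
end

section
/- With M_A as defined in the context: (i) a complex number λ is an eigenvalue of M_A (there exists a nonzero f ∈ dom M_A with M_A f = λ f) if and only if λ² = λ_l² − k₁² + k₂² for some l ∈ ℕ and some k = (k₁,k₂) ∈ ℤ²; (ii) for every λ ∈ ℂ with λ² ≠ λ_l² − k₁² + k₂² for all l ∈ ℕ and k ∈ ℤ², the operator λ·id − M_A is injective with dense range and its inverse is unbounded. Consequently σ(M_A) = ℂ = σ_p(M_A) ∪ σ_c(M_A), with σ_p(M_A) = { ±√(λ_l² − k₁² + k₂²) : l ∈ ℕ, k ∈ ℤ² } and σ_r(M_A) = ∅. -/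
open MeasureTheory

noncomputable section

theorem exists_mulOp_eq_single {ι H : Type*} [DecidableEq ι] [NormedAddCommGroup H]
    [InnerProductSpace ℂ H] (A : ι → (H →ₗ.[ℂ] H)) (i : ι) (v : (A i).domain) :
    ∃ f : (mulOp A).domain, (f : lp (fun _ : ι => H) 2) = lp.single 2 i (v : H) ∧
      mulOp A f = lp.single 2 i (A i v) := by
  have hdom : ∀ k, (lp.single 2 i (v : H) : lp (fun _ : ι => H) 2) k ∈ (A k).domain := by
    intro k
    rcases eq_or_ne k i with rfl | hk
    · rw [lp.single_apply_self]; exact v.2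
    · rw [lp.single_apply_ne _ _ _ hk]; exact zero_mem _
  have happ : ∀ k, A k ⟨_, hdom k⟩ = (lp.single 2 i (A i v) : lp (fun _ : ι => H) 2) k := by
    intro k
    rcases eq_or_ne k i with rfl | hk
    · exact (congrArg (A k) (Subtype.ext (lp.single_apply_self (E := fun _ : ι => H) 2 k v))).trans
        (lp.single_apply_self (E := fun _ : ι => H) 2 k (A k v)).symm
    · exact ((congrArg (A k) (Subtype.ext
        (lp.single_apply_ne (E := fun _ : ι => H) 2 i v hk))).trans (A k).map_zero).trans
        (lp.single_apply_ne (E := fun _ : ι => H) 2 i (A i v) hk).symm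
  refine ⟨⟨lp.single 2 i (v : H), hdom, ?_⟩, rfl, lp.ext (funext happ)⟩
  rw [funext happ]
  exact lp.memℓp _

section IteratedMultiplication

variable {ι κ E : Type*} [NormedAddCommGroup E] [InnerProductSpace ℂ E]

/-- The multiplication operator in `ℓ²(ι, ℓ²(κ, E))` associated to a doubly indexed family of
everywhere defined operators. -/
abbrev iteratedMulOp (T : ι → κ → (E →ₗ[ℂ] E)) :
    lp (fun _ : ι => lp (fun _ : κ => E) 2) 2 →ₗ.[ℂ] lp (fun _ : ι => lp (fun _ : κ => E) 2) 2 :=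
  mulOp fun i => mulOp fun j => (T i j).toPMap ⊤

variable (T : ι → κ → (E →ₗ[ℂ] E))

theorem iteratedMulOp_apply (f : (iteratedMulOp T).domain) (i : ι) (j : κ) :
    (iteratedMulOp T f : lp (fun _ : ι => lp (fun _ : κ => E) 2) 2) i j =
      T i j ((f : lp (fun _ : ι => lp (fun _ : κ => E) 2) 2) i j) := rfl

theorem exists_iteratedMulOp_eq_single [DecidableEq ι] [DecidableEq κ] (i : ι) (j : κ) (v : E) :
    ∃ f : (iteratedMulOp T).domain,
      (f : lp (fun _ : ι => lp (fun _ : κ => E) 2) 2) = lp.single 2 i (lp.single 2 j v) ∧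
      iteratedMulOp T f = lp.single 2 i (lp.single 2 j (T i j v)) := by
  obtain ⟨g, hg, hTg⟩ :=
    exists_mulOp_eq_single (fun j => (T i j).toPMap ⊤) j ⟨v, Submodule.mem_top⟩
  obtain ⟨f, hf, hTf⟩ :=
    exists_mulOp_eq_single (fun i => mulOp fun j => (T i j).toPMap ⊤) i g
  exact ⟨f, by rw [hf, hg], by rw [hTf, hTg]; rfl⟩

theorem exists_iteratedMulOp_eq_smul_iff (c : ℂ) :
    (∃ f : (iteratedMulOp T).domain, f ≠ 0 ∧
      iteratedMulOp T f = c • (f : lp (fun _ : ι => lp (fun _ : κ => E) 2) 2)) ↔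
    ∃ i j, ∃ v, v ≠ 0 ∧ T i j v = c • v := by
  classical
  constructor
  · rintro ⟨f, hf, h⟩
    by_contra! hT
    refine hf (Subtype.ext (lp.ext (funext fun i => lp.ext (funext fun j => ?_))))
    by_contra hne
    refine hT i j _ hne ?_
    rw [← iteratedMulOp_apply, h]
    rfl
  · rintro ⟨i, j, v, hv, h⟩
    obtain ⟨f, hf, hTf⟩ := exists_iteratedMulOp_eq_single T i j v
    refine ⟨f, ?_, by rw [hTf, hf, h, lp.single_smul, lp.single_smul]⟩
    rintro rfl
    have := congrArg norm hf
    rw [lp.norm_single (by norm_num), lp.norm_single (by norm_num)] at this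
    exact hv (norm_eq_zero.mp (by simpa using this.symm))

theorem injective_smul_sub_iteratedMulOp {c : ℂ} (hT : ∀ i j v, T i j v = c • v → v = 0) :
    Function.Injective fun f : (iteratedMulOp T).domain =>
      c • (f : lp (fun _ : ι => lp (fun _ : κ => E) 2) 2) - iteratedMulOp T f := by
  intro f g hfg
  have h : iteratedMulOp T (f - g) =
      c • ((f - g : (iteratedMulOp T).domain) : lp (fun _ : ι => lp (fun _ : κ => E) 2) 2) := by
    rw [LinearPMap.map_sub, Submodule.coe_sub, smul_sub]
    exact (sub_eq_sub_iff_sub_eq_sub.mp hfg).symm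
  by_contra hne
  obtain ⟨i, j, v, hv, hTv⟩ :=
    (exists_iteratedMulOp_eq_smul_iff T c).mp ⟨f - g, sub_ne_zero.mpr hne, h⟩
  exact hv (hT i j v hTv)

theorem dense_range_smul_sub_iteratedMulOp [CompleteSpace E] {c : ℂ}
    (hT : ∀ i j w, ∃ v, c • v - T i j v = w) :
    Dense (Set.range fun f : (iteratedMulOp T).domain =>
      c • (f : lp (fun _ : ι => lp (fun _ : κ => E) 2) 2) - iteratedMulOp T f) := by
  classical
  let K := LinearMap.range (c • (iteratedMulOp T).domain.subtype - (iteratedMulOp T).toFun)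
  change Dense (K : Set (lp (fun _ : ι => lp (fun _ : κ => E) 2) 2))
  rw [Submodule.dense_iff_topologicalClosure_eq_top, Submodule.topologicalClosure_eq_top_iff,
    Submodule.eq_bot_iff]
  intro g hg
  refine lp.ext (funext fun i => lp.ext (funext fun j => ?_))
  obtain ⟨v, hv⟩ := hT i j (g i j)
  obtain ⟨f, hf, hTf⟩ := exists_iteratedMulOp_eq_single T i j v
  have hmem : lp.single 2 i (lp.single 2 j (g i j)) ∈ K := by
    refine ⟨f, ?_⟩
    change c • (f : lp (fun _ : ι => lp (fun _ : κ => E) 2) 2) - iteratedMulOp T f = _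
    rw [hTf, hf, ← hv]
    simp only [lp.single_sub, lp.single_smul]
  have h := (Submodule.mem_orthogonal _ _).mp hg _ hmem
  rw [lp.inner_single_left, lp.inner_single_left] at h
  exact inner_self_eq_zero.mp h

theorem norm_le_of_iteratedMulOp_bound {c : ℂ} {C : ℝ}
    (hC : ∀ f : (iteratedMulOp T).domain, ‖(f : lp (fun _ : ι => lp (fun _ : κ => E) 2) 2)‖ ≤
      C * ‖c • (f : lp (fun _ : ι => lp (fun _ : κ => E) 2) 2) - iteratedMulOp T f‖)
    (i : ι) (j : κ) (v : E) : ‖v‖ ≤ C * ‖c • v - T i j v‖ := by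
  classical
  obtain ⟨f, hf, hTf⟩ := exists_iteratedMulOp_eq_single T i j v
  have h := hC f
  rw [hTf, hf, ← lp.single_smul, ← lp.single_sub, ← lp.single_smul, ← lp.single_sub] at h
  simpa only [lp.norm_single (E := fun _ : ι => lp (fun _ : κ => E) 2) (p := 2) (by norm_num),
    lp.norm_single (E := fun _ : κ => E) (p := 2) (by norm_num)] using h

end IteratedMultiplication

/-- The matrix by which the Dirac operator of a torus product acts on the Fourier mode `k` and an
eigenvalue `a` of the fibre. -/
abbrev fourierModeMatrix (a : ℝ) (k : ℤ × ℤ) : Matrix (Fin 2) (Fin 2) ℂ :=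
  Matrix.of ![![(-a : ℂ), Complex.I * ((k.1 : ℂ) - (k.2 : ℂ))],
    ![Complex.I * ((k.1 : ℂ) + (k.2 : ℂ)), (a : ℂ)]]

theorem det_smul_one_sub_fourierModeMatrix (a : ℝ) (k : ℤ × ℤ) (c : ℂ) :
    (c • (1 : Matrix (Fin 2) (Fin 2) ℂ) - fourierModeMatrix a k).det =
      c ^ 2 - ((a ^ 2 - (k.1 : ℝ) ^ 2 + (k.2 : ℝ) ^ 2 : ℝ) : ℂ) := by
  simp only [Matrix.det_fin_two, Matrix.sub_apply, Matrix.smul_apply, Matrix.of_apply]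
  simp
  linear_combination (-(k.1 : ℂ) ^ 2 + (k.2 : ℂ) ^ 2) * Complex.I_sq

theorem smul_sub_toEuclideanCLM (M : Matrix (Fin 2) (Fin 2) ℂ) (c : ℂ)
    (v : EuclideanSpace ℂ (Fin 2)) :
    c • v - Matrix.toEuclideanCLM (𝕜 := ℂ) M v =
      WithLp.toLp 2 ((c • (1 : Matrix (Fin 2) (Fin 2) ℂ) - M).mulVec v.ofLp) := by
  rw [Matrix.sub_mulVec, Matrix.smul_mulVec, Matrix.one_mulVec]
  rfl

theorem exists_toEuclideanCLM_eq_smul_iff (M : Matrix (Fin 2) (Fin 2) ℂ) (c : ℂ) :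
    (∃ v, v ≠ 0 ∧ Matrix.toEuclideanCLM (𝕜 := ℂ) M v = c • v) ↔
      (c • (1 : Matrix (Fin 2) (Fin 2) ℂ) - M).det = 0 := by
  rw [← Matrix.exists_mulVec_eq_zero_iff]
  constructor
  · rintro ⟨v, hv, h⟩
    refine ⟨v.ofLp, by simpa using hv, ?_⟩
    have := smul_sub_toEuclideanCLM M c v
    rw [h, sub_self] at this
    exact congrArg WithLp.ofLp this.symm
  · rintro ⟨v, hv, h⟩
    refine ⟨WithLp.toLp 2 v, by simpa using hv, ?_⟩
    have := smul_sub_toEuclideanCLM M c (WithLp.toLp 2 v)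
    rw [h, WithLp.toLp_zero] at this
    exact (sub_eq_zero.mp this).symm

theorem exists_smul_sub_toEuclideanCLM_eq {M : Matrix (Fin 2) (Fin 2) ℂ} {c : ℂ}
    (h : (c • (1 : Matrix (Fin 2) (Fin 2) ℂ) - M).det ≠ 0) (w : EuclideanSpace ℂ (Fin 2)) :
    ∃ v, c • v - Matrix.toEuclideanCLM (𝕜 := ℂ) M v = w := by
  refine ⟨WithLp.toLp 2 ((c • (1 : Matrix (Fin 2) (Fin 2) ℂ) - M)⁻¹.mulVec w.ofLp), ?_⟩
  rw [smul_sub_toEuclideanCLM, Matrix.mulVec_mulVec, Matrix.mul_nonsing_inv _ h.isUnit,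
    Matrix.one_mulVec]

/-- On the diagonal modes `(n, n)` the resolvent of the mode matrix grows linearly in `n`. -/
theorem not_forall_norm_le_fourierModeMatrix {a : ℝ} {c : ℂ} (h : c ^ 2 ≠ (a : ℂ) ^ 2) (C : ℝ) :
    ¬ ∀ (n : ℕ) (v : EuclideanSpace ℂ (Fin 2)),
      ‖v‖ ≤ C * ‖c • v - Matrix.toEuclideanCLM (𝕜 := ℂ) (fourierModeMatrix a (n, n)) v‖ := by
  intro hC
  have hca : c - a ≠ 0 := fun h0 => h (by rw [sub_eq_zero.mp h0])
  have key : ∀ n : ℕ, (n : ℝ) ≤ C * ‖c + a‖ * ‖c - a‖ := by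
    intro n
    have himg : c • !₂[c - a, 2 * Complex.I * n] - Matrix.toEuclideanCLM (𝕜 := ℂ)
        (fourierModeMatrix a (n, n)) !₂[c - a, 2 * Complex.I * n] =
          EuclideanSpace.single (0 : Fin 2) ((c + a) * (c - a)) := by
      rw [smul_sub_toEuclideanCLM]
      ext i
      fin_cases i
      · simp [Matrix.mulVec, dotProduct, Fin.sum_univ_two]
      · simp [Matrix.mulVec, dotProduct, Fin.sum_univ_two]
        ring
    have hn := hC n !₂[c - a, 2 * Complex.I * n]
    rw [himg, PiLp.norm_single, norm_mul, ← mul_assoc] at hn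
    have hcoord := PiLp.norm_apply_le (!₂[c - a, 2 * Complex.I * n] : EuclideanSpace ℂ (Fin 2)) 1
    have hnorm : 2 * (n : ℝ) ≤ ‖!₂[c - a, 2 * Complex.I * n]‖ := by simpa using hcoord
    linarith [Nat.cast_nonneg (α := ℝ) n]
  obtain ⟨n, hn⟩ := exists_nat_gt (C * ‖c + a‖ * ‖c - a‖)
  exact absurd (key n) hn.not_ge

/-- Let `(λ_l)` be a sequence of real numbers, `H = ℓ²(ℕ, ℂ²)`, and for
`k = (k₁, k₂) ∈ ℤ²` let `A k` be the operator in `H` acting componentwise by the `2×2`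
matrices `M_l(k) = [[−λ_l, i(k₁−k₂)], [i(k₁+k₂), λ_l]]`; let `M_A` be the generalized
multiplication operator in `ℓ²(ℤ², H)` associated to this family.  Then `λ` is an eigenvalue
of `M_A` iff `λ² = λ_l² − k₁² + k₂²` for some `l ∈ ℕ`, `k ∈ ℤ²`, and for every other `λ` the
operator `λ·id − M_A` is injective with dense range and unbounded inverse; in particular
`σ(M_A) = ℂ = σ_p(M_A) ∪ σ_c(M_A)` with `σ_p(M_A) = {±√(λ_l² − k₁² + k₂²)}` and
`σ_r(M_A) = ∅`. -/
theorem statement18 (lamSeq : ℕ → ℝ)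
    (A : ℤ × ℤ → ((lp (fun _ : ℕ => EuclideanSpace ℂ (Fin 2)) 2) →ₗ.[ℂ]
      (lp (fun _ : ℕ => EuclideanSpace ℂ (Fin 2)) 2)))
    (hA : ∀ k : ℤ × ℤ, A k = mulOp (fun l : ℕ =>
      (Matrix.toEuclideanCLM (𝕜 := ℂ)
        (Matrix.of ![![(-(lamSeq l) : ℂ), Complex.I * ((k.1 : ℂ) - (k.2 : ℂ))],
          ![Complex.I * ((k.1 : ℂ) + (k.2 : ℂ)), ((lamSeq l : ℝ) : ℂ)]])).toLinearMap.toPMap ⊤))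
    (lam : ℂ) :
    ((∃ f : (mulOp A).domain, f ≠ 0 ∧
        mulOp A f = lam •
          (f : lp (fun _ : ℤ × ℤ => lp (fun _ : ℕ => EuclideanSpace ℂ (Fin 2)) 2) 2)) ↔
      ∃ (l : ℕ) (k : ℤ × ℤ),
        lam ^ 2 = ((lamSeq l ^ 2 - (k.1 : ℝ) ^ 2 + (k.2 : ℝ) ^ 2 : ℝ) : ℂ)) ∧
    ((∀ (l : ℕ) (k : ℤ × ℤ),
        lam ^ 2 ≠ ((lamSeq l ^ 2 - (k.1 : ℝ) ^ 2 + (k.2 : ℝ) ^ 2 : ℝ) : ℂ)) →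
      Function.Injective (fun f : (mulOp A).domain =>
        lam • (f : lp (fun _ : ℤ × ℤ => lp (fun _ : ℕ => EuclideanSpace ℂ (Fin 2)) 2) 2) -
          mulOp A f) ∧
      Dense (Set.range fun f : (mulOp A).domain =>
        lam • (f : lp (fun _ : ℤ × ℤ => lp (fun _ : ℕ => EuclideanSpace ℂ (Fin 2)) 2) 2) -
          mulOp A f) ∧
      ¬ ∃ C > (0 : ℝ), ∀ f : (mulOp A).domain,
        ‖(f : lp (fun _ : ℤ × ℤ => lp (fun _ : ℕ => EuclideanSpace ℂ (Fin 2)) 2) 2)‖ ≤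
          C * ‖lam • (f : lp (fun _ : ℤ × ℤ =>
              lp (fun _ : ℕ => EuclideanSpace ℂ (Fin 2)) 2) 2) - mulOp A f‖) := by
  let T : ℤ × ℤ → ℕ → (EuclideanSpace ℂ (Fin 2) →ₗ[ℂ] EuclideanSpace ℂ (Fin 2)) := fun k l =>
    (Matrix.toEuclideanCLM (𝕜 := ℂ) (fourierModeMatrix (lamSeq l) k)).toLinearMap
  obtain rfl : A = fun k => mulOp fun l => (T k l).toPMap ⊤ := funext hA
  have eigen : ∀ k l, (∃ v, v ≠ 0 ∧ T k l v = lam • v) ↔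
      lam ^ 2 = ((lamSeq l ^ 2 - (k.1 : ℝ) ^ 2 + (k.2 : ℝ) ^ 2 : ℝ) : ℂ) := fun k l => by
    rw [← sub_eq_zero, ← det_smul_one_sub_fourierModeMatrix]
    exact exists_toEuclideanCLM_eq_smul_iff _ _
  refine ⟨?_, fun h => ⟨?_, ?_, ?_⟩⟩
  · refine (exists_iteratedMulOp_eq_smul_iff T lam).trans ?_
    simp only [eigen]
    exact exists_comm
  · refine injective_smul_sub_iteratedMulOp T fun k l v hv => ?_
    by_contra hne
    exact h l k ((eigen k l).mp ⟨v, hne, hv⟩)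
  · refine dense_range_smul_sub_iteratedMulOp T fun k l w => exists_smul_sub_toEuclideanCLM_eq ?_ w
    rw [det_smul_one_sub_fourierModeMatrix]
    exact sub_ne_zero.mpr (h l k)
  · rintro ⟨C, -, hC⟩
    refine not_forall_norm_le_fourierModeMatrix (a := lamSeq 0) (c := lam) ?_ C fun n v =>
      norm_le_of_iteratedMulOp_bound T hC (n, n) 0 v
    simpa using h 0 (0, 0)
end
end
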